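/- For every odd prime p, the independence polynomial I(C_p,x) of the cycle on p vertices is irreducible over ℚ; equivalently, I(C_p,x) equals the minimal polynomial over ℚ of −1/(2 + 2cos(π/p)) rescaled to have constant coefficient 1. -/

import Mathlib

open Polynomial SimpleGraph

/-- A finset of vertices is independent if no two of its vertices are adjacent. -/
def SimpleGraph.IsIndepFinset {V : Type*} (G : SimpleGraph V) (s : Finset V) : Prop :=
  ∀ v ∈ s, ∀ w ∈ s, ¬ G.Adj v w

open scoped Classical in
/-- The independence polynomial `I(G,x) = Σ_k i_k(G) xᵏ` of a finite simple graph,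
regarded as a polynomial with rational coefficients. -/
noncomputable def SimpleGraph.indepPoly {V : Type*} [Fintype V] (G : SimpleGraph V) :
    Polynomial ℚ :=
  ∑ s : Finset V, if G.IsIndepFinset s then (X : Polynomial ℚ) ^ s.card else 0

/-- `fPoly m` : the minimal polynomial over `ℚ` of `-1/(2 + 2cos(π/m))`, rescaled so
that its constant coefficient is `1`. -/
noncomputable def fPoly (m : ℕ) : Polynomial ℚ :=
  C ((minpoly ℚ (-1 / (2 + 2 * Real.cos (Real.pi / m)))).coeff 0)⁻¹ *
    minpoly ℚ (-1 / (2 + 2 * Real.cos (Real.pi / m)))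

namespace IndepCycle

lemma mulVec_pow_eq {ι : Type*} [Fintype ι] [DecidableEq ι] (M : Matrix ι ι ℝ) (v : ι → ℝ) (n : ℕ) :
    ∀ a : ι, ((M ^ n).mulVec v) a = ∑ f : Fin n → ι,
      (∏ i : Fin n, M ((Fin.cons a f : Fin (n+1) → ι) i.castSucc) (f i)) *
        v ((Fin.cons a f : Fin (n+1) → ι) (Fin.last n)) := by
  induction n with
  | zero => intro a; simp
  | succ n ih =>
    intro a
    rw [pow_succ', ← Matrix.mulVec_mulVec]
    rw [← (Fin.consEquiv (fun _ : Fin (n+1) => ι)).sum_comp, Fintype.sum_prod_type]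
    simp only [Matrix.mulVec, dotProduct] at ih ⊢
    refine Finset.sum_congr rfl fun b _ => ?_
    rw [ih b, Finset.mul_sum]
    refine Finset.sum_congr rfl fun f _ => ?_
    rw [Fin.prod_univ_succ, ← Fin.succ_last]
    simp [Fin.consEquiv, ← Fin.succ_castSucc, mul_assoc]

lemma trace_pow_eq {ι : Type*} [Fintype ι] [DecidableEq ι] (M : Matrix ι ι ℝ) (n : ℕ) :
    (M ^ (n+1)).trace = ∑ g : Fin (n+1) → ι, ∏ i : Fin (n+1), M (g i) (g (i+1)) := by
  rw [← (Fin.consEquiv (fun _ : Fin (n+1) => ι)).sum_comp, Fintype.sum_prod_type, Matrix.trace]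
  refine Finset.sum_congr rfl fun a _ => ?_
  have h := mulVec_pow_eq M (fun b => M b a) n a
  have h2 : (M ^ (n+1)).diag a = ((M ^ n).mulVec (fun b => M b a)) a := by
    rw [pow_succ]; simp [Matrix.mul_apply, Matrix.mulVec, dotProduct]
  rw [h2, h]
  refine Finset.sum_congr rfl fun f _ => ?_
  rw [Fin.prod_univ_castSucc]
  simp [Fin.consEquiv]

def T (α : ℝ) : Matrix Bool Bool ℝ := fun b c => if b then (if c then 0 else α) else 1

lemma T_sq (α : ℝ) : T α ^ 2 = T α + α • 1 := by
  ext b c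
  rw [pow_two, Matrix.mul_apply]
  cases b <;> cases c <;> simp [T, add_comm]

lemma trace_rec (α : ℝ) (n : ℕ) :
    (T α ^ (n+2)).trace = (T α ^ (n+1)).trace + α * (T α ^ n).trace := by
  rw [pow_add, T_sq, mul_add, ← pow_succ, Matrix.trace_add]; simp

lemma trace_cos (α φ : ℝ) (h : α * (4 * Real.cos φ ^ 2) = -1) (n : ℕ) :
    (T α ^ n).trace * (2 * Real.cos φ) ^ n = 2 * Real.cos (n * φ) := by
  induction n using Nat.twoStepInduction with
  | zero => simp
  | one => simp [Matrix.trace, T]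
  | more n h0 h1 =>
    rw [trace_rec]
    have e : (((n + 2 : ℕ) : ℝ) * φ) = ((n+1 : ℕ) : ℝ) * φ + φ := by push_cast; ring
    have e' : ((n : ℝ) * φ) = ((n+1 : ℕ) : ℝ) * φ - φ := by push_cast; ring
    rw [e, Real.cos_add]
    rw [e', Real.cos_sub] at h0
    linear_combination (2 * Real.cos φ) * h1 - h0 +
      (T α ^ n).trace * (2 * Real.cos φ) ^ n * h

open scoped Classical in
lemma aeval_indep (n : ℕ) (α : ℝ) :
    aeval α ((cycleGraph (n+2)).indepPoly) = (T α ^ (n+2)).trace := by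
  rw [trace_pow_eq, SimpleGraph.indepPoly, map_sum]
  refine Fintype.sum_bijective (fun (s : Finset (Fin (n+2))) (i : Fin (n+2)) => decide (i ∈ s))
    ?_ _ _ ?_
  · constructor
    · intro s t h
      ext i
      simpa using congrFun h i
    · intro f
      refine ⟨Finset.univ.filter (fun i => f i = true), ?_⟩
      ext i; simp
  · intro s
    by_cases h : (cycleGraph (n+2)).IsIndepFinset s
    · have : ∀ i : Fin (n+2), T α (decide (i ∈ s)) (decide (i+1 ∈ s)) = if i ∈ s then α else 1 := by
        intro i
        by_cases hi : i ∈ s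
        · have : i + 1 ∉ s := fun h' => h i hi _ h' (by rw [cycleGraph_adj]; simp)
          simp [T, hi, this]
        · simp [T, hi]
      simp [h, this, Finset.prod_ite]
    · rw [if_neg h, map_zero]
      have : ∃ i, i ∈ s ∧ i + 1 ∈ s := by
        unfold SimpleGraph.IsIndepFinset at h
        push Not at h
        obtain ⟨v, hv, w, hw, hvw⟩ := h
        rw [cycleGraph_adj] at hvw
        rcases hvw with h | h
        · exact ⟨w, hw, by rw [sub_eq_iff_eq_add'] at h; rwa [← h]⟩
        · exact ⟨v, hv, by rw [sub_eq_iff_eq_add'] at h; rwa [← h]⟩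
      obtain ⟨i, hi, hi'⟩ := this
      exact (Finset.prod_eq_zero (Finset.mem_univ i) (by simp [T, hi, hi'])).symm

lemma card_le (n : ℕ) (s : Finset (Fin (n+2))) (h : (cycleGraph (n+2)).IsIndepFinset s) :
    2 * s.card ≤ n + 2 := by
  have hd : Disjoint s (s.map (addRightEmbedding 1)) := by
    rw [Finset.disjoint_left]
    intro v hv hv'
    obtain ⟨w, hw, rfl⟩ := Finset.mem_map.1 hv'
    exact h w hw _ hv (by rw [cycleGraph_adj]; simp)
  have := Finset.card_le_univ (s ∪ s.map (addRightEmbedding 1))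
  rw [Finset.card_union_of_disjoint hd, Finset.card_map, Fintype.card_fin] at this
  omega

lemma natDegree_le (n m : ℕ) (hm : n + 2 = 2 * m + 1) :
    ((cycleGraph (n+2)).indepPoly).natDegree ≤ m := by
  classical
  refine Polynomial.natDegree_sum_le_of_forall_le _ _ fun s _ => ?_
  split_ifs with h
  · rw [natDegree_X_pow]; have := card_le n s h; omega
  · simp

lemma coeff_zero' {V : Type*} [Fintype V] (G : SimpleGraph V) : G.indepPoly.coeff 0 = 1 := by
  classical
  rw [SimpleGraph.indepPoly, finset_sum_coeff, Finset.sum_eq_single ∅]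
  · simp [SimpleGraph.IsIndepFinset]
  · intro s _ hs
    split_ifs
    · rw [coeff_X_pow, if_neg]; exact (Finset.card_pos.2 (Finset.nonempty_iff_ne_empty.2 hs)).ne
    · simp
  · simp

/-- the Eisenstein polynomial -/
noncomputable def Q (m : ℕ) : ℤ[X] :=
  ∑ j ∈ Finset.range (m+1), C ((Nat.choose (2*m+1) (2*j+1) : ℕ) : ℤ) * X ^ j

lemma Q_coeff (m k : ℕ) : (Q m).coeff k = (Nat.choose (2*m+1) (2*k+1) : ℕ) := by
  rw [Q, finset_sum_coeff]
  simp only [coeff_C_mul_X_pow]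
  rw [Finset.sum_ite_eq]
  split_ifs with h
  · rfl
  · rw [Nat.choose_eq_zero_of_lt]; rfl
    simp at h; omega

lemma Q_natDegree (m : ℕ) : (Q m).natDegree = m := by
  apply natDegree_eq_of_le_of_coeff_ne_zero
  · refine natDegree_sum_le_of_forall_le _ _ fun j hj => ?_
    refine (natDegree_C_mul_X_pow_le _ _).trans ?_
    simp at hj; omega
  · rw [Q_coeff]; simp

lemma Q_monic (m : ℕ) : (Q m).Monic := by
  rw [Monic, leadingCoeff, Q_natDegree, Q_coeff]; simp

lemma Q_irred (m : ℕ) (hm : 0 < m) (hp : (2*m+1).Prime) : Irreducible (Q m) := by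
  have hpr : Prime ((2*m+1 : ℕ) : ℤ) := Nat.prime_iff_prime_int.1 hp
  refine irreducible_of_eisenstein_criterion
    (P := Ideal.span {((2*m+1 : ℕ) : ℤ)}) ?_ ?_ ?_ ?_ ?_ (Q_monic m).isPrimitive
  · exact (Ideal.span_singleton_prime hpr.ne_zero).2 hpr
  · rw [(Q_monic m).leadingCoeff, Ideal.mem_span_singleton]
    exact hpr.not_dvd_one
  · intro k hk
    have hk : k < m := by
      rw [← Q_natDegree m]; exact coe_lt_degree.1 hk
    rw [Q_coeff, Ideal.mem_span_singleton, Int.natCast_dvd_natCast]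
    exact hp.dvd_choose_self (by omega) (by omega)
  · rw [← natDegree_pos_iff_degree_pos, Q_natDegree]; exact hm
  · rw [Q_coeff, Ideal.span_singleton_pow, Ideal.mem_span_singleton]
    simp only [mul_zero, zero_add, Nat.choose_one_right]
    intro h
    have h' : (2*m+1)^2 ∣ 2*m+1 := by exact_mod_cast h
    have := Nat.le_of_dvd (by omega) h'
    nlinarith

lemma sum_range_even_odd (f : ℕ → ℝ) (n : ℕ) :
    ∑ i ∈ Finset.range (2*n), f i = ∑ j ∈ Finset.range n, (f (2*j) + f (2*j+1)) := by
  induction n with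
  | zero => simp
  | succ n ih =>
    rw [show 2*(n+1) = 2*n+1+1 by ring, Finset.sum_range_succ, Finset.sum_range_succ,
      Finset.sum_range_succ, ih]; ring

lemma Q_eval (m : ℕ) (t : ℝ) :
    ((1 + t * Complex.I) ^ (2*m+1)).im = t * aeval (-t^2) (Q m) := by
  rw [add_comm, add_pow, Complex.im_sum, show 2*m+1+1 = 2*(m+1) by ring, sum_range_even_odd,
    Q, map_sum, Finset.mul_sum]
  refine Finset.sum_congr rfl fun j _ => ?_
  have hI : ∀ k : ℕ, Complex.I ^ (2*k) = (((-1)^k : ℝ) : ℂ) := by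
    intro k; rw [pow_mul, Complex.I_sq]; push_cast; rfl
  have e1 : ((t:ℂ) * Complex.I) ^ (2*j) * 1 ^ (2*m+1-2*j) * ((2*m+1).choose (2*j) : ℂ) =
      ((t ^ (2*j) * (-1)^j * ((2*m+1).choose (2*j) : ℝ) : ℝ) : ℂ) := by
    rw [mul_pow, hI]; push_cast; ring
  have e2 : ((t:ℂ) * Complex.I) ^ (2*j+1) * 1 ^ (2*m+1-(2*j+1)) * ((2*m+1).choose (2*j+1) : ℂ) =
      ((t ^ (2*j+1) * (-1)^j * ((2*m+1).choose (2*j+1) : ℝ) : ℝ) : ℂ) * Complex.I := by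
    rw [mul_pow, pow_succ Complex.I, hI]; push_cast; ring
  rw [e1, e2, Complex.ofReal_im, Complex.im_ofReal_mul, Complex.I_im]
  simp only [map_mul, map_pow, aeval_X, aeval_C, map_natCast]
  rw [neg_pow (t^2), ← pow_mul]
  ring

lemma Q_root (m : ℕ) (φ : ℝ) (h : (2*m+1) * φ = Real.pi / 2) (h1 : Real.sin φ ≠ 0)
    (h2 : Real.cos φ ≠ 0) : aeval (-(Real.cos φ / Real.sin φ)^2) (Q m) = 0 := by
  have e := Q_eval m (Real.cos φ / Real.sin φ)
  have e2 : ((1 + (Real.cos φ / Real.sin φ : ℝ) * Complex.I) ^ (2*m+1)) =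
      (((-1)^m / Real.sin φ ^ (2*m+1) : ℝ) : ℂ) := by
    have hs : Complex.sin φ ≠ 0 := by exact_mod_cast h1
    have : (1 + (Real.cos φ / Real.sin φ : ℝ) * Complex.I) =
      Complex.I * (Complex.cos (-φ : ℝ) + Complex.sin (-φ : ℝ) * Complex.I) / Real.sin φ := by
      push_cast
      rw [Complex.cos_neg, Complex.sin_neg]
      field_simp
      linear_combination Complex.sin φ * Complex.I_sq
    rw [this, div_pow, mul_pow, Complex.cos_add_sin_mul_I_pow]
    have e3 : ((2*m+1 : ℕ) : ℂ) * ((-φ : ℝ) : ℂ) = ((-(Real.pi / 2) : ℝ) : ℂ) := by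
      rw [← h]; push_cast; ring
    rw [e3, ← Complex.ofReal_cos, ← Complex.ofReal_sin, Real.cos_neg, Real.sin_neg, Real.cos_pi_div_two, Real.sin_pi_div_two,
      pow_succ Complex.I, pow_mul, Complex.I_sq]
    push_cast
    congr 1
    linear_combination (-(-1:ℂ)^m) * Complex.I_sq
  rw [e2, Complex.ofReal_im] at e
  have : Real.cos φ / Real.sin φ ≠ 0 := div_ne_zero h2 h1
  exact (mul_eq_zero.1 e.symm).resolve_left this

end IndepCycle

open IndepCycle in
/-- For an odd prime `p`, the independence polynomial of `C_p` is irreducible over `ℚ`;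
equivalently, it equals the minimal polynomial of `-1/(2 + 2cos(π/p))` over `ℚ`
rescaled to have constant coefficient `1`. -/
theorem indepPoly_cycle_prime_irreducible (p : ℕ) (hp : p.Prime) (hodd : Odd p) :
    Irreducible ((cycleGraph p).indepPoly) ∧ (cycleGraph p).indepPoly = fPoly p := by
  obtain ⟨m, rfl⟩ := hodd
  have hm : 0 < m := by
    rcases Nat.eq_zero_or_pos m with rfl | h
    · exact absurd hp (by norm_num)
    · exact h
  obtain ⟨n, hn⟩ : ∃ n, 2 * m + 1 = n + 2 := ⟨2*m-1, by omega⟩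
  set α : ℝ := -1 / (2 + 2 * Real.cos (Real.pi / (2*m+1 : ℕ))) with hα
  set φ : ℝ := Real.pi / (2 * (2*m+1 : ℕ)) with hφ
  have hpos : (0:ℝ) < (2*m+1 : ℕ) := by positivity
  have hmul : ((2*m+1 : ℕ) : ℝ) * φ = Real.pi / 2 := by rw [hφ]; field_simp
  have hφ0 : 0 < φ := by positivity
  have hφ1 : φ < Real.pi / 2 := by
    rw [← hmul]
    have : (1:ℝ) < (2*m+1 : ℕ) := by exact_mod_cast (by omega : 1 < 2*m+1)
    nlinarith
  have hs : 0 < Real.sin φ := Real.sin_pos_of_pos_of_lt_pi hφ0 (by linarith [Real.pi_pos])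
  have hc : 0 < Real.cos φ := Real.cos_pos_of_mem_Ioo ⟨by linarith [Real.pi_pos], hφ1⟩
  have hα2 : α = -1 / (4 * Real.cos φ ^ 2) := by
    have : Real.pi / (2*m+1 : ℕ) = 2 * φ := by rw [hφ]; field_simp
    rw [hα, this, Real.cos_two_mul]; congr 1; ring
  have hα3 : α * (4 * Real.cos φ ^ 2) = -1 := by rw [hα2]; field_simp
  have hroot : aeval α (cycleGraph (2*m+1)).indepPoly = 0 := by
    have h1 := trace_cos α φ hα3 (2*m+1)
    rw [hmul, Real.cos_pi_div_two, mul_zero] at h1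
    have h2 : (T α ^ (2*m+1)).trace = 0 :=
      (mul_eq_zero.1 h1).resolve_right (pow_ne_zero _ (by positivity))
    rw [hn] at h2 ⊢
    rw [aeval_indep, h2]
  have hdeg : ((cycleGraph (2*m+1)).indepPoly).natDegree ≤ m := by
    have := natDegree_le n m hn.symm
    rwa [← hn] at this
  have h0 := coeff_zero' (cycleGraph (2*m+1))
  set P := (cycleGraph (2*m+1)).indepPoly with hP
  have hP0 : P ≠ 0 := by intro h; rw [h] at h0; simp at h0
  -- degree of α
  set β : ℝ := -(Real.cos φ / Real.sin φ)^2 with hβ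
  have hβroot : aeval β (Q m) = 0 :=
    Q_root m φ (by rw [← hmul]; push_cast; ring) hs.ne' hc.ne'
  have hβroot' : aeval β ((Q m).map (algebraMap ℤ ℚ)) = 0 := by
    rw [aeval_map_algebraMap]; exact hβroot
  have hβint : IsIntegral ℚ β := by
    exact ⟨(Q m).map (algebraMap ℤ ℚ), (Q_monic m).map _, hβroot'⟩
  have hβmin : minpoly ℚ β = (Q m).map (algebraMap ℤ ℚ) := by
    refine (minpoly.eq_of_irreducible_of_monic ?_ ?_ ((Q_monic m).map _)).symm
    · exact ((Q_monic m).irreducible_iff_irreducible_map_fraction_map (K := ℚ)).1 (Q_irred m hm hp)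
    · exact hβroot'
  have hβα : β = (1 + 4 * α)⁻¹ := by
    have : 1 + 4 * α = -(Real.sin φ)^2 / Real.cos φ ^ 2 := by
      rw [hα2]; field_simp; linear_combination Real.sin_sq_add_cos_sq φ
    rw [this, hβ]; field_simp
  have hαint : IsIntegral ℚ α := (isAlgebraic_iff_isIntegral).1 ⟨P, hP0, hroot⟩
  have hle : IntermediateField.adjoin ℚ {β} ≤ IntermediateField.adjoin ℚ {α} := by
    rw [IntermediateField.adjoin_simple_le_iff, hβα]
    have := IntermediateField.mem_adjoin_simple_self ℚ α
    exact inv_mem (add_mem (one_mem _) (mul_mem (ofNat_mem _ 4) this))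
  have hfin : m ≤ (minpoly ℚ α).natDegree := by
    have e1 := IntermediateField.adjoin.finrank hαint
    have e2 := IntermediateField.adjoin.finrank hβint
    rw [hβmin, (Q_monic m).natDegree_map, Q_natDegree] at e2
    rw [← e1, ← e2]
    haveI := IntermediateField.adjoin.finiteDimensional hαint
    exact IntermediateField.finrank_le_of_le_right hle
  obtain ⟨q, hq⟩ := minpoly.dvd ℚ α hroot
  have hq0 : q ≠ 0 := by rintro rfl; exact hP0 (by simpa using hq)
  have hmin0 := minpoly.ne_zero hαint
  have hqd : q.natDegree = 0 := by
    have := congrArg natDegree hq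
    rw [natDegree_mul hmin0 hq0] at this
    omega
  obtain ⟨c, rfl⟩ : ∃ c, q = C c := ⟨_, eq_C_of_natDegree_eq_zero hqd⟩
  have hc0 : c ≠ 0 := by rintro rfl; simp at hq0
  constructor
  · rw [hq]
    exact (irreducible_mul_isUnit (isUnit_C.2 (isUnit_iff_ne_zero.2 hc0))).2 (minpoly.irreducible hαint)
  · have hcc : c = ((minpoly ℚ α).coeff 0)⁻¹ := by
      rw [hq, coeff_mul_C] at h0
      exact eq_inv_of_mul_eq_one_right h0
    rw [hq, fPoly, ← hα, ← hcc, mul_comm]
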